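/- arXiv:1708.01121 — 6 statements merged into one kernel-verified Lean document; each statement's English description precedes it below -/
import Mathlib

section
/- Let H ∈ (0,1/2), β ∈ ℝ and t > 0. For every s₀ ∈ (0,t), the function s ↦ ∫_s^t u^{H−1/2}(u−s)^{H−1/2} e^{β(t−u)} du is differentiable at s₀ and its derivative there equals −t^{H−1/2}(t−s₀)^{H−1/2} + (H−1/2) ∫_{s₀}^t (u−s₀)^{H−1/2} u^{H−3/2} e^{β(t−u)} du − β ∫_{s₀}^t (u−s₀)^{H−1/2} u^{H−1/2} e^{β(t−u)} du. -/
open MeasureTheory Real Set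

/-- Affine substitution onto the unit interval for an integral with a power weight at the left
endpoint. -/
lemma integral_rpow_sub_mul_eq_unit_interval (α : ℝ) {s t : ℝ} (hst : s < t) (h : ℝ → ℝ) :
    ∫ u in s..t, (u - s) ^ α * h u =
      (t - s) ^ (α + 1) * ∫ x in (0:ℝ)..1, x ^ α * h (s + (t - s) * x) := by
  have hpos : 0 < t - s := sub_pos.2 hst
  have key := intervalIntegral.integral_comp_add_mul (a := 0) (b := 1)
    (fun u => (u - s) ^ α * h u) hpos.ne' s
  have hpow : ∫ x in (0:ℝ)..1, (s + (t - s) * x - s) ^ α * h (s + (t - s) * x) =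
      (t - s) ^ α * ∫ x in (0:ℝ)..1, x ^ α * h (s + (t - s) * x) := by
    rw [← intervalIntegral.integral_const_mul]
    refine intervalIntegral.integral_congr fun x hx => ?_
    rw [uIcc_of_le zero_le_one] at hx
    simp only [add_sub_cancel_left]
    rw [mul_rpow hpos.le hx.1, mul_assoc]
  rw [hpow] at key
  simp only [mul_zero, add_zero, mul_one, add_sub_cancel, smul_eq_mul] at key
  rw [rpow_add_one hpos.ne', mul_right_comm, key]
  field_simp

/-- Leibniz rule for a fractional integral with moving lower endpoint, with the derivative moved
onto the smooth factor by integration by parts. -/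
lemma hasDerivAt_integral_rpow_sub_mul {α a t s₀ : ℝ} (hα : -1 < α) (hs₀ : s₀ ∈ Ioo a t)
    {g g' : ℝ → ℝ} (hg : ∀ u, a < u → HasDerivAt g (g' u) u) (hg' : ContinuousOn g' (Ioi a)) :
    HasDerivAt (fun s => ∫ u in s..t, (u - s) ^ α * g u)
      (-((t - s₀) ^ α * g t) + ∫ u in s₀..t, (u - s₀) ^ α * g' u) s₀ := by
  obtain ⟨has, hst⟩ := hs₀
  have hpos : 0 < t - s₀ := sub_pos.2 hst
  obtain ⟨b, hab, hbs⟩ := exists_between has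
  have hgc : ContinuousOn g (Ioi a) := fun u hu => (hg u hu).continuousAt.continuousWithinAt
  have hmaps : ∀ s ∈ Ioo b t, ∀ x ∈ Icc (0:ℝ) 1, s + (t - s) * x ∈ Icc b t := by
    intro s hs x hx
    constructor
    · nlinarith [hs.1, mul_nonneg (sub_pos.2 hs.2).le hx.1]
    · nlinarith [mul_nonneg (sub_pos.2 hs.2).le (sub_nonneg.2 hx.2)]
  have hcomp : ∀ f : ℝ → ℝ, ContinuousOn f (Ioi a) → ∀ s ∈ Ioo b t,
      ContinuousOn (fun x => f (s + (t - s) * x)) (Icc 0 1) := fun f hf s hs =>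
    hf.comp (by fun_prop) fun x hx => hab.trans_le (hmaps s hs x hx).1
  have hpow : IntervalIntegrable (fun x : ℝ => x ^ α) volume 0 1 :=
    intervalIntegral.intervalIntegrable_rpow' hα
  have hint : ∀ f : ℝ → ℝ, ContinuousOn f (Icc 0 1) →
      IntervalIntegrable (fun x => x ^ α * f x) volume 0 1 := fun f hf =>
    hpow.mul_continuousOn (by rwa [uIcc_of_le zero_le_one])
  have hmem : Ioo b t ∈ nhds s₀ := Ioo_mem_nhds hbs hst
  have hs₀ : s₀ ∈ Ioo b t := ⟨hbs, hst⟩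
  obtain ⟨C, hC⟩ := isCompact_Icc.exists_bound_of_continuousOn
    (hg'.mono fun u (hu : u ∈ Icc b t) => hab.trans_le hu.1)
  have hunit : HasDerivAt (fun s => ∫ x in (0:ℝ)..1, x ^ α * g (s + (t - s) * x))
      (∫ x in (0:ℝ)..1, x ^ α * (g' (s₀ + (t - s₀) * x) * (1 - x))) s₀ := by
    refine (intervalIntegral.hasDerivAt_integral_of_dominated_loc_of_deriv_le
      (F' := fun s x => x ^ α * (g' (s + (t - s) * x) * (1 - x)))
      (bound := fun x => x ^ α * C) hmem ?_ ?_ ?_ ?_ ?_ ?_).2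
    · filter_upwards [hmem] with s hs
      exact (hint _ (hcomp g hgc s hs)).aestronglyMeasurable_restrict_uIoc
    · exact hint _ (hcomp g hgc s₀ hs₀)
    · exact (hint (fun x => g' (s₀ + (t - s₀) * x) * (1 - x))
        ((hcomp g' hg' s₀ hs₀).mul (by fun_prop))).aestronglyMeasurable_restrict_uIoc
    · refine Filter.Eventually.of_forall fun x hx s hs => ?_
      rw [uIoc_of_le zero_le_one] at hx
      have hb := hC _ (hmaps s hs x ⟨hx.1.le, hx.2⟩)
      rw [norm_mul, norm_mul, norm_of_nonneg (rpow_nonneg hx.1.le α),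
        norm_of_nonneg (sub_nonneg.2 hx.2)]
      have h1 : 1 - x ≤ 1 := by linarith [hx.1]
      exact mul_le_mul_of_nonneg_left
        ((mul_le_of_le_one_right (norm_nonneg _) h1).trans hb) (rpow_nonneg hx.1.le α)
    · exact hpow.mul_const C
    · refine Filter.Eventually.of_forall fun x hx s hs => ?_
      rw [uIoc_of_le zero_le_one] at hx
      have hinner : HasDerivAt (fun s => s + (t - s) * x) (1 - x) s := by
        refine ((hasDerivAt_id s).add (((hasDerivAt_id s).const_sub t).mul_const x)).congr_deriv ?_
        ring
      exact ((hg _ (hab.trans_le (hmaps s hs x ⟨hx.1.le, hx.2⟩).1)).comp s hinner).const_mul _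
  have hI₁ := hint _ (hcomp g hgc s₀ hs₀)
  have hI₂ := hint _ (hcomp g' hg' s₀ hs₀)
  have hI₃ := hint (fun x => g' (s₀ + (t - s₀) * x) * x)
    ((hcomp g' hg' s₀ hs₀).mul (continuousOn_id (s := Icc 0 1)))
  have hparts : (α + 1) * (∫ x in (0:ℝ)..1, x ^ α * g (s₀ + (t - s₀) * x)) +
      (t - s₀) * (∫ x in (0:ℝ)..1, x ^ α * (g' (s₀ + (t - s₀) * x) * x)) = g t := by
    have hα' : 0 < α + 1 := by linarith
    have hftc := intervalIntegral.integral_eq_sub_of_hasDerivAt_of_le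
      (f := fun x => x ^ (α + 1) * g (s₀ + (t - s₀) * x))
      (f' := fun x => (α + 1) * (x ^ α * g (s₀ + (t - s₀) * x)) +
        (t - s₀) * (x ^ α * (g' (s₀ + (t - s₀) * x) * x)))
      zero_le_one
      ((continuous_id.rpow_const fun _ => Or.inr hα'.le).continuousOn.mul (hcomp g hgc s₀ hs₀))
      (fun x hx => by
        have hlin : HasDerivAt (fun x => s₀ + (t - s₀) * x) (t - s₀) x := by
          simpa using ((hasDerivAt_id x).const_mul (t - s₀)).const_add s₀
        have hcg := (hg _ (hab.trans_le (hmaps s₀ hs₀ x (Ioo_subset_Icc_self hx)).1)).comp x hlin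
        refine ((hasDerivAt_rpow_const (p := α + 1) (Or.inl hx.1.ne')).mul hcg).congr_deriv ?_
        rw [rpow_add_one hx.1.ne', add_sub_cancel_right]
        simp only [Function.comp_apply]
        ring)
      ((hI₁.const_mul _).add (hI₃.const_mul _))
    rw [intervalIntegral.integral_add (hI₁.const_mul _) (hI₃.const_mul _),
      intervalIntegral.integral_const_mul, intervalIntegral.integral_const_mul] at hftc
    simpa [zero_rpow hα'.ne'] using hftc
  have hsplit : ∫ x in (0:ℝ)..1, x ^ α * (g' (s₀ + (t - s₀) * x) * (1 - x)) =
      (∫ x in (0:ℝ)..1, x ^ α * g' (s₀ + (t - s₀) * x)) -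
        ∫ x in (0:ℝ)..1, x ^ α * (g' (s₀ + (t - s₀) * x) * x) := by
    rw [← intervalIntegral.integral_sub hI₂ hI₃]
    congr 1 with x
    ring
  have hfactor : HasDerivAt (fun s => (t - s) ^ (α + 1)) (-((α + 1) * (t - s₀) ^ α)) s₀ := by
    refine (((hasDerivAt_id s₀).const_sub t).rpow_const (p := α + 1)
      (Or.inl hpos.ne')).congr_deriv ?_
    simp
    ring
  have heq : (fun s => ∫ u in s..t, (u - s) ^ α * g u) =ᶠ[nhds s₀]
      fun s => (t - s) ^ (α + 1) * ∫ x in (0:ℝ)..1, x ^ α * g (s + (t - s) * x) := by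
    filter_upwards [hmem] with s hs
    exact integral_rpow_sub_mul_eq_unit_interval α hs.2 g
  refine ((hfactor.mul hunit).congr_of_eventuallyEq heq).congr_deriv ?_
  rw [integral_rpow_sub_mul_eq_unit_interval α hst g', hsplit, ← hparts, rpow_add_one hpos.ne']
  ring

theorem stmt1 (H β t s₀ : ℝ) (hH : H ∈ Set.Ioo (0:ℝ) (1/2)) (ht : 0 < t)
    (hs₀ : s₀ ∈ Set.Ioo (0:ℝ) t) :
    HasDerivAt
      (fun s => ∫ u in Set.Ioo s t, u ^ (H - 1/2) * (u - s) ^ (H - 1/2) * Real.exp (β * (t - u)))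
      (-(t ^ (H - 1/2) * (t - s₀) ^ (H - 1/2))
        + (H - 1/2) *
            (∫ u in Set.Ioo s₀ t, (u - s₀) ^ (H - 1/2) * u ^ (H - 3/2) * Real.exp (β * (t - u)))
        - β *
            (∫ u in Set.Ioo s₀ t, (u - s₀) ^ (H - 1/2) * u ^ (H - 1/2) * Real.exp (β * (t - u))))
      s₀ := by
  have hα : -1 < H - 1/2 := by linarith [hH.1]
  have hIoo : ∀ s < t, ∀ f : ℝ → ℝ, ∫ u in Ioo s t, f u = ∫ u in s..t, f u := fun s hs f => by
    rw [intervalIntegral.integral_of_le hs.le, integral_Ioc_eq_integral_Ioo]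
  have hcont : ∀ p : ℝ, ContinuousOn (fun u : ℝ => u ^ p * exp (β * (t - u))) (Ioi 0) := fun p =>
    (continuousOn_id.rpow_const fun u hu => Or.inl (ne_of_gt hu)).mul (by fun_prop)
  have hint : ∀ p : ℝ, IntervalIntegrable
      (fun u => (u - s₀) ^ (H - 1/2) * (u ^ p * exp (β * (t - u)))) volume s₀ t := fun p => by
    refine IntervalIntegrable.mul_continuousOn ?_ ((hcont p).mono fun u hu => ?_)
    · simpa using
        (intervalIntegral.intervalIntegrable_rpow' (a := 0) (b := t - s₀) hα).comp_sub_right s₀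
    · rw [uIcc_of_le hs₀.2.le] at hu
      exact hs₀.1.trans_le hu.1
  have hmain := hasDerivAt_integral_rpow_sub_mul hα hs₀
    (g := fun u => u ^ (H - 1/2) * exp (β * (t - u)))
    (g' := fun u => (H - 1/2) * (u ^ (H - 3/2) * exp (β * (t - u))) -
      β * (u ^ (H - 1/2) * exp (β * (t - u))))
    (fun u hu => by
      have hexp : HasDerivAt (fun u => exp (β * (t - u))) (exp (β * (t - u)) * (β * -1)) u :=
        (((hasDerivAt_id u).const_sub t).const_mul β).exp
      refine ((hasDerivAt_rpow_const (p := H - 1/2) (Or.inl hu.ne')).mul hexp).congr_deriv ?_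
      rw [show H - 1/2 - 1 = H - 3/2 by ring]
      ring)
    (((hcont _).const_mul _).sub ((hcont _).const_mul _))
  have heq : (fun s => ∫ u in Ioo s t, u ^ (H - 1/2) * (u - s) ^ (H - 1/2) * exp (β * (t - u)))
      =ᶠ[nhds s₀]
      fun s => ∫ u in s..t, (u - s) ^ (H - 1/2) * (u ^ (H - 1/2) * exp (β * (t - u))) := by
    filter_upwards [Iio_mem_nhds hs₀.2] with s hs
    rw [hIoo s hs]
    congr 1 with u
    ring
  refine (hmain.congr_of_eventuallyEq heq).congr_deriv ?_
  have hsplit : ∫ u in s₀..t, (u - s₀) ^ (H - 1/2) *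
        ((H - 1/2) * (u ^ (H - 3/2) * exp (β * (t - u))) - β * (u ^ (H - 1/2) * exp (β * (t - u)))) =
      (H - 1/2) * (∫ u in s₀..t, (u - s₀) ^ (H - 1/2) * (u ^ (H - 3/2) * exp (β * (t - u)))) -
        β * ∫ u in s₀..t, (u - s₀) ^ (H - 1/2) * (u ^ (H - 1/2) * exp (β * (t - u))) := by
    rw [← intervalIntegral.integral_const_mul, ← intervalIntegral.integral_const_mul,
      ← intervalIntegral.integral_sub ((hint _).const_mul _) ((hint _).const_mul _)]
    congr 1 with u
    ring
  rw [hsplit, hIoo s₀ hs₀.2, hIoo s₀ hs₀.2]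
  simp only [sub_self, mul_zero, exp_zero, mul_one, mul_assoc]
  ring
end

section
/- Let H ∈ (1/2,1), β ∈ ℝ and t > 0. For every s₀ ∈ (0,t), the function s ↦ ∫_s^t u^{H−1/2}(u−s)^{H−1/2} e^{β(t−u)} du is differentiable at s₀ and its derivative there equals −(H−1/2) ∫_{s₀}^t u^{H−1/2} (u−s₀)^{H−3/2} e^{β(t−u)} du. -/
open MeasureTheory Real Set

/-- The positive-part power `y ↦ max y 0 ^ a` is Lipschitz at every nonzero point `x`, with
constant `|x| ^ (a - 1)`. -/
theorem abs_max_zero_rpow_sub_le {a x : ℝ} (ha : 0 < a) (ha1 : a ≤ 1) (hx : x ≠ 0) (y : ℝ) :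
    |max y 0 ^ a - max x 0 ^ a| ≤ |x| ^ (a - 1) * |y - x| := by
  have split : ∀ z : ℝ, 0 < z → z ^ a = z * z ^ (a - 1) := fun z hz => by
    rw [rpow_sub_one hz.ne', mul_div_cancel₀ _ hz.ne']
  rcases lt_or_gt_of_ne hx with hx | hx
  · rw [max_eq_right hx.le, zero_rpow ha.ne', sub_zero, abs_of_neg hx]
    have hq : 0 < -x := by linarith
    rcases le_or_gt y 0 with hy | hy
    · rw [max_eq_right hy, zero_rpow ha.ne', abs_zero]
      positivity
    · rw [max_eq_left hy.le, abs_of_pos (by positivity), abs_of_pos (by linarith)]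
      have hqp : 0 < (-x) ^ (a - 1) := by positivity
      rcases le_total y (-x) with h | h
      · have h1 : y ^ a ≤ (-x) ^ a := rpow_le_rpow hy.le h ha.le
        rw [split _ hq] at h1
        nlinarith
      · have h1 : y ^ (a - 1) ≤ (-x) ^ (a - 1) := rpow_le_rpow_of_nonpos hq h (by linarith)
        rw [split _ hy]
        nlinarith
  · rw [max_eq_left hx.le, abs_of_pos hx]
    have hxp : 0 < x ^ (a - 1) := by positivity
    rcases le_or_gt y 0 with hy | hy
    · rw [max_eq_right hy, zero_rpow ha.ne', zero_sub, abs_neg, abs_of_pos (by positivity),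
        abs_of_neg (by linarith), split _ hx]
      nlinarith
    · rw [max_eq_left hy.le]
      rcases le_total x y with h | h
      · have h1 : y ^ (a - 1) ≤ x ^ (a - 1) := rpow_le_rpow_of_nonpos hx h (by linarith)
        have h2 : x ^ a ≤ y ^ a := rpow_le_rpow hx.le h ha.le
        rw [abs_of_nonneg (by linarith), abs_of_nonneg (by linarith), split _ hx, split _ hy]
        nlinarith
      · have h1 : x ^ (a - 1) ≤ y ^ (a - 1) := rpow_le_rpow_of_nonpos hy h (by linarith)
        have h2 : y ^ a ≤ x ^ a := rpow_le_rpow hy.le h ha.le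
        rw [abs_of_nonpos (by linarith), abs_of_nonpos (by linarith), split _ hx, split _ hy]
        nlinarith

theorem intervalIntegrable_abs_rpow {r : ℝ} (hr : -1 < r) (b c : ℝ) :
    IntervalIntegrable (fun x : ℝ => |x| ^ r) volume b c := by
  refine intervalIntegrable_of_even (fun x => by rw [abs_neg]) (fun x hx => ?_)
  refine (intervalIntegral.intervalIntegrable_rpow' hr).congr fun u hu => ?_
  rw [uIoc_of_le hx.le] at hu
  simp only [abs_of_pos hu.1]

theorem hasDerivAt_max_sub_zero_rpow {a u s₀ : ℝ} (ha : 0 < a) (hu : u ≠ s₀) :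
    HasDerivAt (fun s => max (u - s) 0 ^ a)
      ((Ioi s₀).indicator (fun u => -a * (u - s₀) ^ (a - 1)) u) s₀ := by
  rcases lt_or_gt_of_ne hu with hu | hu
  · rw [indicator_of_notMem (by simpa using hu.le)]
    refine (hasDerivAt_const s₀ (0 : ℝ)).congr_of_eventuallyEq ?_
    filter_upwards [lt_mem_nhds hu] with s hs
    rw [max_eq_right (by linarith), zero_rpow ha.ne']
  · rw [indicator_of_mem (mem_Ioi.2 hu)]
    have h := ((hasDerivAt_id s₀).const_sub u).rpow_const (p := a)
      (Or.inl (sub_pos.2 hu).ne')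
    refine (h.congr_of_eventuallyEq ?_).congr_deriv (by simp)
    filter_upwards [gt_mem_nhds hu] with s hs
    rw [max_eq_left (by linarith), id]

/-- Leibniz rule for the fractional kernel `(u - s) ^ a`, `0 < a ≤ 1`, against a continuous
weight. -/
theorem hasDerivAt_setIntegral_mul_sub_rpow {a b t s₀ : ℝ} {g : ℝ → ℝ} (ha : 0 < a) (ha1 : a ≤ 1)
    (hs₀ : s₀ ∈ Ioo b t) (hg : ContinuousOn g (Icc b t)) :
    HasDerivAt (fun s => ∫ u in Ioo s t, g u * (u - s) ^ a)
      (∫ u in Ioo s₀ t, -a * (g u * (u - s₀) ^ (a - 1))) s₀ := by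
  have hbt : b ≤ t := (hs₀.1.trans hs₀.2).le
  have hcont : ∀ s : ℝ, ContinuousOn (fun u => g u * max (u - s) 0 ^ a) (Icc b t) := fun s =>
    hg.mul (((continuous_id.sub continuous_const).max continuous_const).rpow_const
      fun _ => Or.inr ha.le).continuousOn
  have hint : ∀ s : ℝ, IntegrableOn (fun u => g u * max (u - s) 0 ^ a) (Ioo b t) := fun s =>
    (hcont s).integrableOn_Icc.mono_set Ioo_subset_Icc_self
  set c : ℝ → ℝ := fun u => g u * (Ioi s₀).indicator (fun u => -a * (u - s₀) ^ (a - 1)) u with hc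
  have hgm : AEStronglyMeasurable g (volume.restrict (Ioo b t)) :=
    (hg.mono Ioo_subset_Icc_self).aestronglyMeasurable measurableSet_Ioo
  have hcm : AEStronglyMeasurable c (volume.restrict (Ioo b t)) :=
    hgm.mul ((Measurable.indicator (by fun_prop) measurableSet_Ioi).aestronglyMeasurable)
  have hne : ∀ᵐ u ∂volume.restrict (Ioo b t), u ≠ s₀ :=
    ae_restrict_of_ae (Measure.ae_ne volume s₀)
  have hbound : IntegrableOn (fun u => |g u| * |u - s₀| ^ (a - 1)) (Ioo b t) := by
    have h : IntervalIntegrable (fun u : ℝ => |u - s₀| ^ (a - 1)) volume b t := by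
      simpa using (intervalIntegrable_abs_rpow (by linarith : -1 < a - 1)
        (b - s₀) (t - s₀)).comp_sub_right s₀
    have h' := h.continuousOn_mul (g := fun u => |g u|) (by rw [uIcc_of_le hbt]; exact hg.abs)
    exact ((intervalIntegrable_iff_integrableOn_Ioc_of_le hbt).1 h').mono_set Ioo_subset_Ioc_self
  obtain ⟨hFi, key⟩ := hasFDerivAt_integral_of_dominated_loc_of_lip' (𝕜 := ℝ)
    (F := fun s u => g u * max (u - s) 0 ^ a) (x₀ := s₀) (μ := volume.restrict (Ioo b t))
    (F' := fun u => ContinuousLinearMap.toSpanSingleton ℝ (c u))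
    (bound := fun u => |g u| * |u - s₀| ^ (a - 1)) Filter.univ_mem
    (fun s _ => (hint s).aestronglyMeasurable) (hint s₀)
    ((ContinuousLinearMap.toSpanSingletonCLE (𝕜 := ℝ) (E := ℝ)).continuous.comp_aestronglyMeasurable
      hcm)
    (by
      filter_upwards [hne] with u hu s _
      have h := abs_max_zero_rpow_sub_le ha ha1 (sub_ne_zero.2 hu) (u - s)
      rw [← mul_sub, norm_mul, norm_eq_abs, norm_eq_abs, norm_eq_abs, mul_assoc]
      rw [sub_sub_sub_cancel_left, abs_sub_comm s₀ s] at h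
      exact mul_le_mul_of_nonneg_left h (abs_nonneg _))
    hbound
    (by
      filter_upwards [hne] with u hu
      exact ((hasDerivAt_max_sub_zero_rpow ha hu).const_mul (g u)).hasFDerivAt)
  refine (key.hasDerivAt.congr_of_eventuallyEq ?_).congr_deriv ?_
  · filter_upwards [lt_mem_nhds hs₀.1] with s hs
    rw [setIntegral_eq_of_subset_of_forall_sdiff_eq_zero measurableSet_Ioo
      (Ioo_subset_Ioo_left hs.le)]
    · refine setIntegral_congr_fun measurableSet_Ioo fun u hu => ?_
      simp only [max_eq_left (sub_nonneg.2 hu.1.le)]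
    · rintro u ⟨hu, hu'⟩
      have : u ≤ s := not_lt.1 fun h => hu' ⟨h, hu.2⟩
      rw [max_eq_right (by linarith), zero_rpow ha.ne', mul_zero]
  · rw [ContinuousLinearMap.integral_apply hFi]
    simp only [ContinuousLinearMap.toSpanSingleton_apply, one_smul]
    rw [setIntegral_eq_of_subset_of_forall_sdiff_eq_zero measurableSet_Ioo
      (Ioo_subset_Ioo_left hs₀.1.le)]
    · refine setIntegral_congr_fun measurableSet_Ioo fun u hu => ?_
      simp only [hc, indicator_of_mem (mem_Ioi.2 hu.1)]
      ring
    · rintro u ⟨hu, hu'⟩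
      have : u ∉ Ioi s₀ := fun h => hu' ⟨h, hu.2⟩
      simp only [hc, indicator_of_notMem this, mul_zero]

theorem stmt2 (H β t s₀ : ℝ) (hH : H ∈ Set.Ioo (1/2:ℝ) 1) (ht : 0 < t)
    (hs₀ : s₀ ∈ Set.Ioo (0:ℝ) t) :
    HasDerivAt
      (fun s => ∫ u in Set.Ioo s t, u ^ (H - 1/2) * (u - s) ^ (H - 1/2) * Real.exp (β * (t - u)))
      (-(H - 1/2) *
        (∫ u in Set.Ioo s₀ t, u ^ (H - 1/2) * (u - s₀) ^ (H - 3/2) * Real.exp (β * (t - u))))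
      s₀ := by
  have ha : 0 < H - 1/2 := by linarith [hH.1]
  have hg : Continuous fun u : ℝ => u ^ (H - 1/2) * Real.exp (β * (t - u)) :=
    (continuous_id.rpow_const fun _ => Or.inr ha.le).mul (by fun_prop)
  have h := hasDerivAt_setIntegral_mul_sub_rpow ha (by linarith [hH.2]) hs₀ hg.continuousOn
  rw [integral_const_mul, show H - 1/2 - 1 = H - 3/2 by ring] at h
  simpa only [mul_right_comm] using h
end

section
/- Let H ∈ (1/2,1), ξ > 0, β > 0 and t ∈ (0,1]. Then F^H(t,s) ≥ ξ κ_H (t−s)^{H−1/2} > 0 for every s ∈ (0,t), and the function s ↦ 1/F^H(t,s) is square integrable on (0,t), i.e. ∫_0^t F^H(t,s)^{−2} ds < ∞. -/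
open MeasureTheory Real Set

/-- The constant `κ_H`. -/
noncomputable def kappaH (H : ℝ) : ℝ :=
  Real.sqrt (2 * H * Real.Gamma (3/2 - H) / (Real.Gamma (H + 1/2) * Real.Gamma (2 - 2*H)))

/-- The Volterra kernel `F^H` of the fractional Ornstein–Uhlenbeck process for `H > 1/2`. -/
noncomputable def Fhigh (ξ β H t s : ℝ) : ℝ :=
  ξ * kappaH H * (H - 1/2) * s ^ ((1:ℝ)/2 - H) *
    ∫ u in Set.Ioo s t, u ^ (H - 1/2) * (u - s) ^ (H - 3/2) * Real.exp (β * (t - u))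

theorem integrableOn_Ioo_sub_rpow {a s t : ℝ} (ha : -1 < a) (hst : s ≤ t) :
    IntegrableOn (fun u => (u - s) ^ a) (Set.Ioo s t) := by
  have h := (intervalIntegral.intervalIntegrable_rpow' (a := 0) (b := t - s) ha).comp_sub_right s
  simp only [zero_add, sub_add_cancel] at h
  exact (intervalIntegrable_iff_integrableOn_Ioo_of_le hst).1 h

theorem integral_Ioo_sub_rpow {a s t : ℝ} (ha : -1 < a) (hst : s ≤ t) :
    ∫ u in Set.Ioo s t, (u - s) ^ a = (t - s) ^ (a + 1) / (a + 1) := by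
  rw [← integral_Ioc_eq_integral_Ioo, ← intervalIntegral.integral_of_le hst,
    intervalIntegral.integral_comp_sub_right (fun x => x ^ a) s, sub_self,
    integral_rpow (Or.inl ha), zero_rpow (by linarith), sub_zero]

theorem integrableOn_Ioo_sub_rpow_right {a s t : ℝ} (ha : -1 < a) (hst : s ≤ t) :
    IntegrableOn (fun u => (t - u) ^ a) (Set.Ioo s t) := by
  have h := (intervalIntegral.intervalIntegrable_rpow' (a := t - s) (b := 0) ha).comp_sub_left t
  simp only [sub_sub_cancel, sub_zero] at h
  exact (intervalIntegrable_iff_integrableOn_Ioo_of_le hst).1 h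

theorem kappaH_pos {H : ℝ} (hH : H ∈ Set.Ioo (1/2 : ℝ) 1) : 0 < kappaH H := by
  obtain ⟨h1, h2⟩ := hH
  have g1 : 0 < Real.Gamma (3/2 - H) := Real.Gamma_pos_of_pos (by linarith)
  have g2 : 0 < Real.Gamma (H + 1/2) := Real.Gamma_pos_of_pos (by linarith)
  have g3 : 0 < Real.Gamma (2 - 2*H) := Real.Gamma_pos_of_pos (by linarith)
  have h0 : 0 < H := by linarith
  exact Real.sqrt_pos.2 (by positivity)

theorem integrableOn_Fhigh_integrand {H β s t : ℝ} (hH : 1/2 < H) (hs : s ∈ Set.Ioo 0 t) :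
    IntegrableOn (fun u => u ^ (H - 1/2) * (u - s) ^ (H - 3/2) * Real.exp (β * (t - u)))
      (Set.Ioo s t) := by
  have hint : IntegrableOn (fun u => (u - s) ^ (H - 3/2)) (Set.Icc s t) :=
    integrableOn_Icc_iff_integrableOn_Ioo (by simp) (by simp) |>.2
      (integrableOn_Ioo_sub_rpow (by linarith) hs.2.le)
  have hcont : ContinuousOn (fun u => u ^ (H - 1/2) * Real.exp (β * (t - u))) (Set.Icc s t) :=
    (continuousOn_id.rpow_const fun _ _ => Or.inr (by linarith)).mul (by fun_prop)
  refine ((hint.continuousOn_mul hcont isCompact_Icc).mono_set Set.Ioo_subset_Icc_self).congr_fun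
    (fun u _ => ?_) measurableSet_Ioo
  simp only
  ring

theorem le_Fhigh {H ξ β s t : ℝ} (hH : 1/2 < H) (hξ : 0 ≤ ξ) (hβ : 0 ≤ β)
    (hs : s ∈ Set.Ioo 0 t) :
    ξ * kappaH H * (t - s) ^ (H - 1/2) ≤ Fhigh ξ β H t s := by
  have hc : 0 < H - 1/2 := by linarith
  have hs0 : 0 < s := hs.1
  have hκ : 0 ≤ kappaH H := Real.sqrt_nonneg _
  have key : s ^ (H - 1/2) * ((t - s) ^ (H - 1/2) / (H - 1/2)) ≤
      ∫ u in Set.Ioo s t, u ^ (H - 1/2) * (u - s) ^ (H - 3/2) * Real.exp (β * (t - u)) := by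
    have hi := integral_Ioo_sub_rpow (a := H - 3/2) (by linarith) hs.2.le
    rw [show H - 3/2 + 1 = H - 1/2 by ring] at hi
    rw [← hi, ← integral_const_mul]
    refine setIntegral_mono_on
      ((integrableOn_Ioo_sub_rpow (by linarith) hs.2.le).const_mul _)
      (integrableOn_Fhigh_integrand hH hs) measurableSet_Ioo fun u hu => ?_
    have h1 : s ^ (H - 1/2) ≤ u ^ (H - 1/2) := rpow_le_rpow hs0.le hu.1.le hc.le
    have h2 : 0 ≤ (u - s) ^ (H - 3/2) := rpow_nonneg (sub_nonneg.2 hu.1.le) _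
    have h3 : 1 ≤ Real.exp (β * (t - u)) :=
      one_le_exp (mul_nonneg hβ (sub_nonneg.2 hu.2.le))
    have h4 : 0 ≤ u ^ (H - 1/2) * (u - s) ^ (H - 3/2) :=
      mul_nonneg (rpow_nonneg (hs0.trans hu.1).le _) h2
    exact (mul_le_mul_of_nonneg_right h1 h2).trans (le_mul_of_one_le_right h4 h3)
  have hpow : s ^ ((1:ℝ)/2 - H) * s ^ (H - 1/2) = 1 := by
    rw [← rpow_add hs0]
    simp
  calc ξ * kappaH H * (t - s) ^ (H - 1/2)
      = ξ * kappaH H * (t - s) ^ (H - 1/2) * (s ^ ((1:ℝ)/2 - H) * s ^ (H - 1/2)) := by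
        rw [hpow, mul_one]
    _ = ξ * kappaH H * (t - s) ^ (H - 1/2) * (s ^ ((1:ℝ)/2 - H) * s ^ (H - 1/2)) *
        ((H - 1/2) / (H - 1/2)) := by
        rw [div_self hc.ne', mul_one]
    _ = ξ * kappaH H * (H - 1/2) * s ^ ((1:ℝ)/2 - H) *
        (s ^ (H - 1/2) * ((t - s) ^ (H - 1/2) / (H - 1/2))) := by
        ring
    _ ≤ Fhigh ξ β H t s := mul_le_mul_of_nonneg_left key (by positivity)

theorem measurable_Fhigh (ξ β H t : ℝ) : Measurable (Fhigh ξ β H t) := by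
  have hint : Measurable fun s : ℝ => ∫ u in Set.Ioo s t,
      u ^ (H - 1/2) * (u - s) ^ (H - 3/2) * Real.exp (β * (t - u)) := by
    let S : Set (ℝ × ℝ) := {p | p.1 < p.2 ∧ p.2 < t}
    have hS : MeasurableSet S :=
      (measurableSet_lt measurable_fst measurable_snd).inter
        (measurableSet_lt measurable_snd measurable_const)
    let f : ℝ × ℝ → ℝ := fun p =>
      p.2 ^ (H - 1/2) * (p.2 - p.1) ^ (H - 3/2) * Real.exp (β * (t - p.2))
    have hf : Measurable f := by fun_prop
    convert ((hf.indicator hS).stronglyMeasurable.integral_prod_right'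
      (ν := volume)).measurable using 2 with s
    rw [← integral_indicator measurableSet_Ioo]
    rfl
  unfold Fhigh
  exact (measurable_const.mul (by fun_prop)).mul hint

theorem stmt4 (H ξ β t : ℝ) (hH : H ∈ Set.Ioo (1/2:ℝ) 1) (hξ : 0 < ξ) (hβ : 0 < β)
    (ht : t ∈ Set.Ioc (0:ℝ) 1) :
    (∀ s ∈ Set.Ioo (0:ℝ) t,
      ξ * kappaH H * (t - s) ^ (H - 1/2) ≤ Fhigh ξ β H t s ∧
      0 < ξ * kappaH H * (t - s) ^ (H - 1/2)) ∧
    MeasureTheory.IntegrableOn (fun s => ((Fhigh ξ β H t s)⁻¹) ^ 2) (Set.Ioo 0 t) := by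
  have hκ := kappaH_pos hH
  have hbound : ∀ s ∈ Set.Ioo (0:ℝ) t,
      ξ * kappaH H * (t - s) ^ (H - 1/2) ≤ Fhigh ξ β H t s ∧
      0 < ξ * kappaH H * (t - s) ^ (H - 1/2) := fun s hs =>
    ⟨le_Fhigh hH.1 hξ.le hβ.le hs,
      mul_pos (mul_pos hξ hκ) (rpow_pos_of_pos (sub_pos.2 hs.2) _)⟩
  refine ⟨hbound, ?_⟩
  refine Integrable.mono'
    ((integrableOn_Ioo_sub_rpow_right (a := 1 - 2 * H) (by linarith [hH.2]) ht.1.le).const_mul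
      (((ξ * kappaH H)⁻¹) ^ 2))
    ((measurable_Fhigh ξ β H t).inv.pow_const 2).aestronglyMeasurable ?_
  refine (ae_restrict_iff' measurableSet_Ioo).2 (Filter.Eventually.of_forall fun s hs => ?_)
  obtain ⟨h1, h2⟩ := hbound s hs
  have hts : 0 < t - s := sub_pos.2 hs.2
  have hpow : (((t - s) ^ (H - 1/2))⁻¹) ^ 2 = (t - s) ^ (1 - 2 * H) := by
    rw [← rpow_neg hts.le, ← rpow_mul_natCast hts.le]
    congr 1
    push_cast
    ring
  rw [Real.norm_of_nonneg (sq_nonneg _), ← hpow, ← mul_pow, ← mul_inv]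
  exact pow_le_pow_left₀ (inv_nonneg.2 (h2.le.trans h1)) (inv_anti₀ h2 h1) 2
end

section
/- Let H ∈ (0,1)\{1/2}, ξ > 0, β > 0 and t ∈ (0,1]. Then the function s ↦ F^H(t,s) is square integrable on (0,t), i.e. ∫_0^t F^H(t,s)² ds < ∞. -/
open MeasureTheory Real Set

/-- The Volterra kernel `F^H` of the fractional Ornstein–Uhlenbeck process. -/
noncomputable def FH (ξ β H t s : ℝ) : ℝ :=
  if H < 1/2 then
    ξ * kappaH H * s ^ ((1:ℝ)/2 - H) *
      ((t * (t - s)) ^ (H - 1/2) +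
        ∫ u in Set.Ioo s t,
          ((1 - 2*H) / (2*u) + β) * (u * (u - s)) ^ (H - 1/2) * Real.exp (β * (t - u)))
  else
    ξ * kappaH H * (H - 1/2) * s ^ ((1:ℝ)/2 - H) *
      ∫ u in Set.Ioo s t, u ^ (H - 1/2) * (u - s) ^ (H - 3/2) * Real.exp (β * (t - u))

theorem integrableOn_sub_rpow {s t r : ℝ} (hst : s ≤ t) (hr : -1 < r) :
    IntegrableOn (fun u => (u - s) ^ r) (Ioo s t) := by
  have h := (intervalIntegral.intervalIntegrable_rpow' (a := s - s) (b := t - s) hr).comp_sub_right s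
  rw [sub_add_cancel, sub_add_cancel, intervalIntegrable_iff_integrableOn_Ioo_of_le hst] at h
  exact h

theorem integrableOn_rev_sub_rpow {t r : ℝ} (ht : 0 ≤ t) (hr : -1 < r) :
    IntegrableOn (fun s => (t - s) ^ r) (Ioo 0 t) := by
  have h := (intervalIntegral.intervalIntegrable_rpow' (a := 0) (b := t) hr).comp_sub_left t
  rw [sub_zero, sub_self] at h
  have h' := h.symm
  rwa [intervalIntegrable_iff_integrableOn_Ioo_of_le ht] at h'

theorem setIntegral_sub_rpow_le {s t r : ℝ} (hst : s ≤ t) (hst' : t - s ≤ 1) (hr : -1 < r) :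
    ∫ u in Ioo s t, (u - s) ^ r ≤ 1 / (r + 1) := by
  rw [← integral_Ioc_eq_integral_Ioo, ← intervalIntegral.integral_of_le hst,
    intervalIntegral.integral_comp_sub_right (fun x => x ^ r) s, integral_rpow (Or.inl hr),
    sub_self, zero_rpow (by linarith), sub_zero]
  have : (t - s) ^ (r + 1) ≤ 1 := rpow_le_one (by linarith) hst' (by linarith)
  have h0 : 0 < r + 1 := by linarith
  gcongr

/-- A set integral dominated by a multiple of an integrable power singularity. -/
theorem abs_setIntegral_le_of_le_sub_rpow {s t r K : ℝ} {f : ℝ → ℝ} (hst : s ≤ t)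
    (hst' : t - s ≤ 1) (hr : -1 < r) (hK : 0 ≤ K)
    (hf : ∀ u ∈ Ioo s t, |f u| ≤ K * (u - s) ^ r) :
    |∫ u in Ioo s t, f u| ≤ K * (1 / (r + 1)) := by
  calc |∫ u in Ioo s t, f u| ≤ ∫ u in Ioo s t, K * (u - s) ^ r :=
        norm_integral_le_of_norm_le (f := f) ((integrableOn_sub_rpow hst hr).const_mul K)
          (ae_restrict_of_forall_mem measurableSet_Ioo hf)
    _ = K * ∫ u in Ioo s t, (u - s) ^ r := integral_const_mul _ _
    _ ≤ K * (1 / (r + 1)) := by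
        gcongr
        exact setIntegral_sub_rpow_le hst hst' hr

theorem measurable_setIntegral_Ioo (t : ℝ) {f : ℝ → ℝ → ℝ}
    (hf : Measurable (Function.uncurry f)) :
    Measurable fun s => ∫ u in Ioo s t, f s u := by
  have hS : MeasurableSet {p : ℝ × ℝ | p.1 < p.2 ∧ p.2 < t} :=
    (measurableSet_lt measurable_fst measurable_snd).inter
      (measurableSet_lt measurable_snd measurable_const)
  have h := (hf.indicator hS).stronglyMeasurable.integral_prod_right' (ν := volume)
  convert h.measurable using 2 with s
  rw [← integral_indicator measurableSet_Ioo]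
  rfl

theorem measurable_FH (ξ β H t : ℝ) : Measurable fun s => FH ξ β H t s := by
  unfold FH
  split_ifs
  · have h := measurable_setIntegral_Ioo t (f := fun s u =>
      ((1 - 2*H) / (2*u) + β) * (u * (u - s)) ^ (H - 1/2) * Real.exp (β * (t - u)))
      (by unfold Function.uncurry; fun_prop)
    fun_prop
  · have h := measurable_setIntegral_Ioo t (f := fun s u =>
      u ^ (H - 1/2) * (u - s) ^ (H - 3/2) * Real.exp (β * (t - u)))
      (by unfold Function.uncurry; fun_prop)
    fun_prop

/-- The bound on the Volterra kernel in the regular regime `1/2 < H`. -/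
theorem abs_FH_le_of_half_lt {H ξ β t s : ℝ} (hH : 1/2 < H) (hβ : 0 ≤ β) (ht : t ≤ 1)
    (hs : s ∈ Ioo 0 t) :
    |FH ξ β H t s| ≤
      |ξ * kappaH H * (H - 1/2)| * (exp β * (1 / (H - 3/2 + 1))) * s ^ (1/2 - H) := by
  obtain ⟨hs0, hst⟩ := hs
  rw [FH, if_neg (by linarith), abs_mul, abs_mul, abs_of_pos (rpow_pos_of_pos hs0 _)]
  have key := abs_setIntegral_le_of_le_sub_rpow (s := s) (t := t) (r := H - 3/2) (K := exp β)
    (f := fun u => u ^ (H - 1/2) * (u - s) ^ (H - 3/2) * exp (β * (t - u)))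
    hst.le (by linarith) (by linarith) (exp_pos _).le (by
      rintro u ⟨hsu, hut⟩
      have hu : 0 < u := hs0.trans hsu
      have hus : 0 < u - s := sub_pos.2 hsu
      rw [abs_of_nonneg (by positivity)]
      calc u ^ (H - 1/2) * (u - s) ^ (H - 3/2) * exp (β * (t - u))
          ≤ 1 * (u - s) ^ (H - 3/2) * exp β := by
            gcongr
            · exact rpow_le_one hu.le (by linarith) (by linarith)
            · exact mul_le_of_le_one_right hβ (by linarith)
        _ = exp β * (u - s) ^ (H - 3/2) := by ring)
  rw [mul_right_comm]
  gcongr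

/-- The bound on the Volterra kernel in the singular regime `H < 1/2`: the exponent `b` absorbs
the singularity of the inner integral at `s = 0`. -/
theorem abs_FH_le_of_lt_half {H ξ β t s b : ℝ} (hH : H < 1/2) (hβ : 0 ≤ β) (ht : t ≤ 1)
    (hs : s ∈ Ioo 0 t) (hb : 1 - 2*H < b) (hb' : b < 1 - H) :
    |FH ξ β H t s| ≤ |ξ * kappaH H| *
      ((t - s) ^ (H - 1/2) +
        (1/2 - H + β) * exp β * (1 / (b + 2*H - 2 + 1)) * s ^ (1/2 - H - b)) := by
  obtain ⟨hs0, hst⟩ := hs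
  have ht0 : 0 < t := hs0.trans hst
  have hts : 0 < t - s := sub_pos.2 hst
  have hc : 0 ≤ 1/2 - H + β := by linarith
  have key := abs_setIntegral_le_of_le_sub_rpow (s := s) (t := t) (r := b + 2*H - 2)
    (K := (1/2 - H + β) * exp β * s ^ (-b))
    (f := fun u => ((1 - 2*H) / (2*u) + β) * (u * (u - s)) ^ (H - 1/2) * exp (β * (t - u)))
    hst.le (by linarith) (by linarith) (by positivity) (by
      rintro u ⟨hsu, hut⟩
      have hu : 0 < u := hs0.trans hsu
      have hus : 0 < u - s := sub_pos.2 hsu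
      have hH2 : 0 ≤ 1 - 2*H := by linarith
      rw [abs_of_nonneg (by positivity)]
      have h1 : (1 - 2*H) / (2*u) + β ≤ (1/2 - H + β) * u ^ (-1 : ℝ) := by
        rw [rpow_neg_one, ← div_eq_mul_inv, le_div_iff₀ hu]
        have : ((1 - 2*H) / (2*u) + β) * u = 1/2 - H + β * u := by
          field_simp
        nlinarith
      have h2 : u ^ (-1 : ℝ) * u ^ (H - 1/2) ≤ s ^ (-b) * (u - s) ^ (b + H - 3/2) := by
        rw [← rpow_add hu, show (-1 : ℝ) + (H - 1/2) = -b + (b + H - 3/2) by ring, rpow_add hu]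
        gcongr ?_ * ?_
        · exact rpow_le_rpow_of_nonpos hs0 hsu.le (by linarith)
        · exact rpow_le_rpow_of_nonpos hus (by linarith) (by linarith)
      rw [mul_rpow hu.le hus.le]
      calc ((1 - 2*H) / (2*u) + β) * (u ^ (H - 1/2) * (u - s) ^ (H - 1/2)) * exp (β * (t - u))
          ≤ ((1/2 - H + β) * u ^ (-1 : ℝ)) * (u ^ (H - 1/2) * (u - s) ^ (H - 1/2)) * exp β := by
            gcongr
            exact mul_le_of_le_one_right hβ (by linarith)
        _ = (1/2 - H + β) * exp β * (u ^ (-1 : ℝ) * u ^ (H - 1/2)) * (u - s) ^ (H - 1/2) := by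
            ring
        _ ≤ (1/2 - H + β) * exp β * (s ^ (-b) * (u - s) ^ (b + H - 3/2))
              * (u - s) ^ (H - 1/2) := by gcongr
        _ = (1/2 - H + β) * exp β * s ^ (-b) * ((u - s) ^ (b + H - 3/2)
              * (u - s) ^ (H - 1/2)) := by ring
        _ = (1/2 - H + β) * exp β * s ^ (-b) * (u - s) ^ (b + 2*H - 2) := by
            rw [← rpow_add hus]
            ring_nf)
  have first : s ^ (1/2 - H) * (t * (t - s)) ^ (H - 1/2) ≤ (t - s) ^ (H - 1/2) := by
    rw [mul_rpow ht0.le hts.le, ← mul_assoc]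
    have : s ^ (1/2 - H) * t ^ (H - 1/2) ≤ 1 :=
      calc s ^ (1/2 - H) * t ^ (H - 1/2) ≤ t ^ (1/2 - H) * t ^ (H - 1/2) := by
            gcongr
        _ = 1 := by
            rw [← rpow_add ht0]
            norm_num
    exact mul_le_of_le_one_left (by positivity) this
  rw [FH, if_pos hH, abs_mul, abs_mul, abs_of_pos (rpow_pos_of_pos hs0 _), mul_assoc]
  gcongr ?_ * ?_
  calc s ^ (1/2 - H) * |(t * (t - s)) ^ (H - 1/2) + ∫ u in Ioo s t,
          ((1 - 2*H) / (2*u) + β) * (u * (u - s)) ^ (H - 1/2) * exp (β * (t - u))|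
      ≤ s ^ (1/2 - H) * ((t * (t - s)) ^ (H - 1/2) +
          (1/2 - H + β) * exp β * s ^ (-b) * (1 / (b + 2*H - 2 + 1))) := by
        gcongr
        refine (abs_add_le _ _).trans (add_le_add (abs_of_nonneg (by positivity)).le key)
    _ = s ^ (1/2 - H) * (t * (t - s)) ^ (H - 1/2) +
          (1/2 - H + β) * exp β * (1 / (b + 2*H - 2 + 1)) * (s ^ (1/2 - H) * s ^ (-b)) := by
        ring
    _ ≤ _ := by
        rw [← rpow_add hs0, ← sub_eq_add_neg]
        gcongr

theorem stmt8 (H ξ β t : ℝ) (hH : H ∈ Set.Ioo (0:ℝ) 1) (hH' : H ≠ 1/2)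
    (hξ : 0 < ξ) (hβ : 0 < β) (ht : t ∈ Set.Ioc (0:ℝ) 1) :
    MeasureTheory.IntegrableOn (fun s => (FH ξ β H t s) ^ 2) (Set.Ioo 0 t) := by
  obtain ⟨hH0, hH1⟩ := hH
  obtain ⟨ht0, ht1⟩ := ht
  have hmeas : AEStronglyMeasurable (fun s => (FH ξ β H t s) ^ 2) (volume.restrict (Ioo 0 t)) :=
    ((measurable_FH ξ β H t).pow_const 2).aestronglyMeasurable
  have hpow : ∀ r : ℝ, -1 < r → IntegrableOn (fun s : ℝ => s ^ r) (Ioo 0 t) := fun r hr => by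
    simpa using integrableOn_sub_rpow ht0.le hr
  have hsq : ∀ {x : ℝ}, 0 ≤ x → ∀ r : ℝ, x ^ (2 * r) = (x ^ r) ^ 2 := fun hx r => by
    rw [mul_comm, rpow_mul hx, rpow_two]
  rcases lt_or_gt_of_ne hH' with h | h
  · obtain ⟨b, hb, hb'⟩ := exists_between (show 1 - 2*H < 1 - H by linarith)
    set A := |ξ * kappaH H|
    set B := (1/2 - H + β) * exp β * (1 / (b + 2*H - 2 + 1))
    have hint : IntegrableOn (fun s => 2 * A ^ 2 *
        ((t - s) ^ (2 * (H - 1/2)) + B ^ 2 * s ^ (2 * (1/2 - H - b)))) (Ioo 0 t) :=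
      ((integrableOn_rev_sub_rpow ht0.le (by linarith)).add
        ((hpow _ (by linarith)).const_mul _)).const_mul _
    refine hint.mono' hmeas (ae_restrict_of_forall_mem measurableSet_Ioo fun s hs => ?_)
    have hF := abs_FH_le_of_lt_half (ξ := ξ) h hβ.le ht1 hs hb hb'
    rw [norm_eq_abs, abs_pow, hsq (sub_nonneg.2 hs.2.le), hsq hs.1.le]
    calc |FH ξ β H t s| ^ 2
        ≤ (A * ((t - s) ^ (H - 1/2) + B * s ^ (1/2 - H - b))) ^ 2 := by gcongr
      _ = A ^ 2 * ((t - s) ^ (H - 1/2) + B * s ^ (1/2 - H - b)) ^ 2 := mul_pow _ _ _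
      _ ≤ A ^ 2 * (2 * (((t - s) ^ (H - 1/2)) ^ 2 + (B * s ^ (1/2 - H - b)) ^ 2)) := by
          gcongr
          exact add_sq_le
      _ = _ := by ring
  · set A := |ξ * kappaH H * (H - 1/2)| * (exp β * (1 / (H - 3/2 + 1)))
    have hint : IntegrableOn (fun s : ℝ => A ^ 2 * s ^ (2 * (1/2 - H))) (Ioo 0 t) :=
      (hpow _ (by linarith)).const_mul _
    refine hint.mono' hmeas (ae_restrict_of_forall_mem measurableSet_Ioo fun s hs => ?_)
    have hF := abs_FH_le_of_half_lt (ξ := ξ) h hβ.le ht1 hs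
    rw [norm_eq_abs, abs_pow, hsq hs.1.le, ← mul_pow]
    gcongr
end

section
/- Let H ∈ (0,1/2), ξ > 0, β < 0, ε > 0 and 0 < s < t. Then (G^H_ε(t,s) − G^H_0(t,s))² ≤ 2 κ_H² ξ² s^{1−2H} [ (H−1/2)² (∫_s^t (u−s)^{H−1/2} u^{H−3/2} du)² + β² ε⁴ (∫_s^t (u(u−s))^{H−1/2} du)² ]. -/
open MeasureTheory Real Set

/-- The rescaled Volterra kernel `G^H_ε` of the fractional Ornstein–Uhlenbeck process. -/
noncomputable def Geps (ξ β H ε t s : ℝ) : ℝ :=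
  if H < 1/2 then
    ξ * kappaH H * s ^ ((1:ℝ)/2 - H) *
      ((t * (t - s)) ^ (H - 1/2) +
        ∫ u in Set.Ioo s t,
          ((1 - 2*H) / (2*u) + β * ε ^ 2) * (u * (u - s)) ^ (H - 1/2) *
            Real.exp (β * ε ^ 2 * (t - u)))
  else if H = 1/2 then ξ * Real.exp (β * ε ^ 2 * (t - s))
  else
    ξ * kappaH H * (H - 1/2) * s ^ ((1:ℝ)/2 - H) *
      ∫ u in Set.Ioo s t, u ^ (H - 1/2) * (u - s) ^ (H - 3/2) * Real.exp (β * ε ^ 2 * (t - u))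

/-- The limiting Volterra kernel `G^H_0`. -/
noncomputable def Gzero (ξ H t s : ℝ) : ℝ :=
  if H < 1/2 then
    ξ * kappaH H * s ^ ((1:ℝ)/2 - H) *
      ((t * (t - s)) ^ (H - 1/2) -
        (H - 1/2) * ∫ u in Set.Ioo s t, (u - s) ^ (H - 1/2) * u ^ (H - 3/2))
  else if H = 1/2 then ξ
  else
    ξ * kappaH H * (H - 1/2) * s ^ ((1:ℝ)/2 - H) *
      ∫ u in Set.Ioo s t, u ^ (H - 1/2) * (u - s) ^ (H - 3/2)

/-- A shifted power with exponent above `-1` times a function continuous on `[s, t]` is integrable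
on `(s, t)`. -/
theorem integrableOn_sub_rpow_mul {p s t : ℝ} {h : ℝ → ℝ} (hp : -1 < p) (hst : s ≤ t)
    (hh : ContinuousOn h (Set.Icc s t)) :
    IntegrableOn (fun u => (u - s) ^ p * h u) (Set.Ioo s t) := by
  rw [← intervalIntegrable_iff_integrableOn_Ioo_of_le hst]
  have h1 : IntervalIntegrable (fun u : ℝ => (u - s) ^ p) volume s t := by
    simpa using
      (intervalIntegral.intervalIntegrable_rpow' (a := 0) (b := t - s) hp).comp_sub_right s
  exact h1.mul_continuousOn (by rwa [Set.uIcc_of_le hst])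

/-- Damping a nonnegative integrand by a factor in `[0, 1]` keeps its integral between `0` and the
undamped integral. -/
theorem setIntegral_mul_mem_Icc {S : Set ℝ} {f E : ℝ → ℝ} (hS : MeasurableSet S)
    (hf : IntegrableOn f S) (hfE : IntegrableOn (fun u => f u * E u) S)
    (hf0 : ∀ u ∈ S, 0 ≤ f u) (hE : ∀ u ∈ S, E u ∈ Set.Icc (0 : ℝ) 1) :
    ∫ u in S, f u * E u ∈ Set.Icc 0 (∫ u in S, f u) :=
  ⟨setIntegral_nonneg hS fun u hu => mul_nonneg (hf0 u hu) (hE u hu).1,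
    setIntegral_mono_on hfE hf hS fun u hu => mul_le_of_le_one_right (hf0 u hu) (hE u hu).2⟩

theorem stmt14 (H ξ β ε t s : ℝ) (hH : H ∈ Set.Ioo (0:ℝ) (1/2)) (hξ : 0 < ξ) (hβ : β < 0)
    (hε : 0 < ε) (hs : 0 < s) (hst : s < t) :
    (Geps ξ β H ε t s - Gzero ξ H t s) ^ 2 ≤
      2 * (kappaH H) ^ 2 * ξ ^ 2 * s ^ (1 - 2*H) *
        ((H - 1/2) ^ 2 * (∫ u in Set.Ioo s t, (u - s) ^ (H - 1/2) * u ^ (H - 3/2)) ^ 2 +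
          β ^ 2 * ε ^ 4 * (∫ u in Set.Ioo s t, (u * (u - s)) ^ (H - 1/2)) ^ 2) := by
  obtain ⟨hH0, hH1⟩ := hH
  have hp : -1 < H - 1/2 := by linarith
  set c : ℝ := β * ε ^ 2 with hc
  have hc0 : c ≤ 0 := mul_nonpos_of_nonpos_of_nonneg hβ.le (sq_nonneg ε)
  have hcont (q : ℝ) : ContinuousOn (fun u : ℝ => u ^ q) (Set.Icc s t) :=
    continuousOn_id.rpow_const fun u hu => Or.inl (hs.trans_le hu.1).ne'
  have hE : Continuous fun u : ℝ => Real.exp (c * (t - u)) := by fun_prop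
  have hE01 (u : ℝ) (hu : u ∈ Set.Ioo s t) : Real.exp (c * (t - u)) ∈ Set.Icc (0 : ℝ) 1 :=
    ⟨(Real.exp_pos _).le, Real.exp_le_one_iff.2
      (mul_nonpos_of_nonpos_of_nonneg hc0 (sub_nonneg.2 hu.2.le))⟩
  have hg (u : ℝ) (hu : u ∈ Set.Ioo s t) :
      (u - s) ^ (H - 1/2) * u ^ (H - 1/2) = (u * (u - s)) ^ (H - 1/2) := by
    rw [Real.mul_rpow (hs.trans hu.1).le (sub_nonneg.2 hu.1.le), mul_comm]
  have hfi := integrableOn_sub_rpow_mul hp hst.le (hcont (H - 3/2))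
  have hgi : IntegrableOn (fun u : ℝ => (u * (u - s)) ^ (H - 1/2)) (Set.Ioo s t) :=
    (integrableOn_sub_rpow_mul hp hst.le (hcont (H - 1/2))).congr_fun hg measurableSet_Ioo
  have hfEi : IntegrableOn
      (fun u : ℝ => (u - s) ^ (H - 1/2) * u ^ (H - 3/2) * Real.exp (c * (t - u)))
      (Set.Ioo s t) := by
    simpa only [mul_assoc, Pi.mul_apply] using
      integrableOn_sub_rpow_mul hp hst.le ((hcont (H - 3/2)).mul hE.continuousOn)
  have hgEi : IntegrableOn
      (fun u : ℝ => (u * (u - s)) ^ (H - 1/2) * Real.exp (c * (t - u))) (Set.Ioo s t) :=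
    (integrableOn_sub_rpow_mul hp hst.le ((hcont (H - 1/2)).mul hE.continuousOn)).congr_fun
      (fun u hu => by simp only [← hg u hu, mul_assoc, Pi.mul_apply]) measurableSet_Ioo
  have hf := setIntegral_mul_mem_Icc measurableSet_Ioo hfi hfEi
    (fun u hu => mul_nonneg (Real.rpow_nonneg (sub_nonneg.2 hu.1.le) _)
      (Real.rpow_nonneg (hs.trans hu.1).le _)) hE01
  have hgm := setIntegral_mul_mem_Icc measurableSet_Ioo hgi hgEi
    (fun u hu => Real.rpow_nonneg
      (mul_nonneg (hs.trans hu.1).le (sub_nonneg.2 hu.1.le)) _) hE01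
  have hsplit : ∫ u in Set.Ioo s t, ((1 - 2*H) / (2*u) + c) * (u * (u - s)) ^ (H - 1/2) *
        Real.exp (c * (t - u)) =
      (1/2 - H) * (∫ u in Set.Ioo s t,
        (u - s) ^ (H - 1/2) * u ^ (H - 3/2) * Real.exp (c * (t - u))) +
      c * ∫ u in Set.Ioo s t, (u * (u - s)) ^ (H - 1/2) * Real.exp (c * (t - u)) := by
    rw [← integral_const_mul, ← integral_const_mul,
      ← integral_add (hfEi.const_mul _) (hgEi.const_mul _)]
    refine setIntegral_congr_fun measurableSet_Ioo fun u hu => ?_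
    have hu0 : 0 < u := hs.trans hu.1
    have hpow : u ^ (H - 3/2) = u ^ (H - 1/2) / u := by
      rw [← Real.rpow_sub_one hu0.ne']
      ring_nf
    simp only [← hg u hu, hpow]
    field_simp
  have hs2 : s ^ (1 - 2*H) = (s ^ ((1:ℝ)/2 - H)) ^ 2 := by
    rw [← Real.rpow_natCast, ← Real.rpow_mul hs.le]
    push_cast
    ring_nf
  have hbe : β ^ 2 * ε ^ 4 = c ^ 2 := by rw [hc]; ring
  rw [Geps, Gzero, if_pos hH1, if_pos hH1, ← hc, hsplit, hs2, hbe]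
  generalize (∫ u in Set.Ioo s t,
    (u - s) ^ (H - 1/2) * u ^ (H - 3/2) * Real.exp (c * (t - u))) = FE at *
  generalize (∫ u in Set.Ioo s t,
    (u * (u - s)) ^ (H - 1/2) * Real.exp (c * (t - u))) = GE at *
  generalize (∫ u in Set.Ioo s t, (u - s) ^ (H - 1/2) * u ^ (H - 3/2)) = F at *
  generalize (∫ u in Set.Ioo s t, (u * (u - s)) ^ (H - 1/2)) = G at *
  have hF2 : (F - FE) ^ 2 ≤ F ^ 2 :=
    pow_le_pow_left₀ (sub_nonneg.2 hf.2) (sub_le_self _ hf.1) 2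
  have hG2 : GE ^ 2 ≤ G ^ 2 := pow_le_pow_left₀ hgm.1 hgm.2 2
  calc _ = (ξ * kappaH H * s ^ ((1:ℝ)/2 - H)) ^ 2 *
        ((H - 1/2) * (F - FE) + c * GE) ^ 2 := by ring
    _ ≤ (ξ * kappaH H * s ^ ((1:ℝ)/2 - H)) ^ 2 *
        (2 * (((H - 1/2) * (F - FE)) ^ 2 + (c * GE) ^ 2)) := by
      gcongr
      exact add_sq_le
    _ = (ξ * kappaH H * s ^ ((1:ℝ)/2 - H)) ^ 2 *
        (2 * ((H - 1/2) ^ 2 * (F - FE) ^ 2 + c ^ 2 * GE ^ 2)) := by ring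
    _ ≤ (ξ * kappaH H * s ^ ((1:ℝ)/2 - H)) ^ 2 *
        (2 * ((H - 1/2) ^ 2 * F ^ 2 + c ^ 2 * G ^ 2)) := by gcongr
    _ = _ := by ring
end

section
/- Let H ∈ (0,1)\{1/2} and t ∈ (0,1]. Then the Volterra kernel s ↦ K^H(t,s) is square integrable on (0,t), i.e. ∫_0^t K^H(t,s)² ds < ∞. -/
open MeasureTheory Real Set

/-- The Volterra kernel `K^H` of fractional Brownian motion. -/
noncomputable def KH (H t s : ℝ) : ℝ :=
  if H < 1/2 then
    kappaH H * s ^ ((1:ℝ)/2 - H) *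
      ((t * (t - s)) ^ (H - 1/2) -
        (H - 1/2) * ∫ u in Set.Ioo s t, (u - s) ^ (H - 1/2) * u ^ (H - 3/2))
  else
    kappaH H * (H - 1/2) * s ^ ((1:ℝ)/2 - H) *
      ∫ u in Set.Ioo s t, u ^ (H - 1/2) * (u - s) ^ (H - 3/2)

theorem measurable_setIntegral_Ioo_left {f : ℝ → ℝ → ℝ}
    (hf : Measurable (Function.uncurry f)) (t : ℝ) :
    Measurable fun s => ∫ u in Set.Ioo s t, f s u := by
  have hset : MeasurableSet {p : ℝ × ℝ | p.1 < p.2 ∧ p.2 < t} :=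
    (measurableSet_lt measurable_fst measurable_snd).inter
      (measurableSet_lt measurable_snd measurable_const)
  have h := ((hf.indicator hset).stronglyMeasurable.integral_prod_right'
    (ν := (volume : Measure ℝ))).measurable
  convert h using 2 with s
  rw [← integral_indicator measurableSet_Ioo]
  rfl

theorem integrableOn_Ioo_sub_left_rpow {s t a : ℝ} (hst : s ≤ t) (ha : -1 < a) :
    IntegrableOn (fun u => (u - s) ^ a) (Set.Ioo s t) := by
  have h := (intervalIntegral.intervalIntegrable_rpow' (a := 0) (b := t - s) ha).comp_sub_right s
  rw [zero_add, sub_add_cancel] at h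
  exact (intervalIntegrable_iff_integrableOn_Ioo_of_le hst).1 h

theorem integrableOn_Ioo_sub_right_rpow {s t a : ℝ} (hst : s ≤ t) (ha : -1 < a) :
    IntegrableOn (fun u => (t - u) ^ a) (Set.Ioo s t) := by
  have h := (intervalIntegral.intervalIntegrable_rpow' (a := t - s) (b := 0) ha).comp_sub_left t
  rw [sub_sub_cancel, sub_zero] at h
  exact (intervalIntegrable_iff_integrableOn_Ioo_of_le hst).1 h

theorem setIntegral_Ioo_sub_left_rpow {s t a : ℝ} (hst : s ≤ t) (ha : -1 < a) :
    ∫ u in Set.Ioo s t, (u - s) ^ a = (t - s) ^ (a + 1) / (a + 1) := by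
  rw [← integral_Ioc_eq_integral_Ioo, ← intervalIntegral.integral_of_le hst,
    intervalIntegral.integral_comp_sub_right (fun x => x ^ a), integral_rpow (Or.inl ha),
    sub_self, zero_rpow (by linarith), sub_zero]

theorem abs_setIntegral_Ioo_le_of_le_rpow {f : ℝ → ℝ} {s t a C : ℝ} (hst : s ≤ t)
    (hlen : t - s ≤ 1) (ha : -1 < a) (hC : 0 ≤ C)
    (hf : ∀ u ∈ Set.Ioo s t, |f u| ≤ C * (u - s) ^ a) :
    |∫ u in Set.Ioo s t, f u| ≤ C / (a + 1) := by
  have hb := norm_integral_le_of_norm_le (f := f)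
    ((integrableOn_Ioo_sub_left_rpow hst ha).const_mul C)
    ((ae_restrict_iff' measurableSet_Ioo).2 (Filter.Eventually.of_forall hf))
  rw [integral_const_mul, setIntegral_Ioo_sub_left_rpow hst ha] at hb
  have h1 : (t - s) ^ (a + 1) ≤ 1 := rpow_le_one (by linarith) hlen (by linarith)
  have h2 : 0 < a + 1 := by linarith
  calc |∫ u in Set.Ioo s t, f u| ≤ C * ((t - s) ^ (a + 1) / (a + 1)) := hb
    _ ≤ C * (1 / (a + 1)) := by gcongr
    _ = C / (a + 1) := by ring

theorem measurable_KH (H t : ℝ) : Measurable (KH H t) := by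
  unfold KH
  split_ifs
  · have h := measurable_setIntegral_Ioo_left
      (f := fun s u => (u - s) ^ (H - 1/2) * u ^ (H - 3/2))
      (by unfold Function.uncurry; fun_prop) t
    fun_prop
  · have h := measurable_setIntegral_Ioo_left
      (f := fun s u => u ^ (H - 1/2) * (u - s) ^ (H - 3/2))
      (by unfold Function.uncurry; fun_prop) t
    fun_prop

theorem abs_KH_le_of_half_lt {H s t : ℝ} (hH : 1/2 < H) (hs : 0 < s) (hst : s < t)
    (ht : t ≤ 1) : |KH H t s| ≤ kappaH H * s ^ ((1:ℝ)/2 - H) := by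
  have hk : 0 ≤ kappaH H := Real.sqrt_nonneg _
  have hI : |∫ u in Set.Ioo s t, u ^ (H - 1/2) * (u - s) ^ (H - 3/2)|
      ≤ 1 / (H - 3/2 + 1) := by
    refine abs_setIntegral_Ioo_le_of_le_rpow hst.le (by linarith) (by linarith) zero_le_one ?_
    rintro u ⟨hu, hut⟩
    have h1 : 0 ≤ (u - s) ^ (H - 3/2) := rpow_nonneg (by linarith) _
    have h2 : 0 ≤ u ^ (H - 1/2) := rpow_nonneg (by linarith) _
    rw [abs_of_nonneg (mul_nonneg h2 h1)]
    gcongr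
    exact rpow_le_one (by linarith) (by linarith) (by linarith)
  have hH0 : 0 < H - 1/2 := by linarith
  have hs0 : 0 ≤ s ^ ((1:ℝ)/2 - H) := rpow_nonneg hs.le _
  rw [KH, if_neg hH.not_gt, abs_mul,
    abs_of_nonneg (mul_nonneg (mul_nonneg hk hH0.le) hs0)]
  calc _ ≤ kappaH H * (H - 1/2) * s ^ ((1:ℝ)/2 - H) * (1 / (H - 3/2 + 1)) := by gcongr
    _ = kappaH H * s ^ ((1:ℝ)/2 - H) := by
      rw [show H - 3/2 + 1 = H - 1/2 by ring]
      generalize H - 1/2 = h at hH0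
      field_simp

theorem abs_KH_le_of_lt_half {H s t : ℝ} (hH0 : 0 < H) (hH : H < 1/2) (hs : 0 < s)
    (hst : s < t) (ht : t ≤ 1) :
    |KH H t s| ≤
      kappaH H * ((t - s) ^ (H - 1/2) + (1/2 - H) * (2 / H) * s ^ (H/2 - 1/2)) := by
  have hk : 0 ≤ kappaH H := Real.sqrt_nonneg _
  have hI : |∫ u in Set.Ioo s t, (u - s) ^ (H - 1/2) * u ^ (H - 3/2)|
      ≤ s ^ (3/2 * H - 1) / (H/2 - 1 + 1) := by
    refine abs_setIntegral_Ioo_le_of_le_rpow hst.le (by linarith) (by linarith)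
      (rpow_nonneg hs.le _) ?_
    rintro u ⟨hu, hut⟩
    have hus : 0 < u - s := by linarith
    have hu0 : 0 < u := by linarith
    rw [abs_of_nonneg (by positivity)]
    calc (u - s) ^ (H - 1/2) * u ^ (H - 3/2)
        = (u - s) ^ (H - 1/2) * (u ^ (3/2 * H - 1) * u ^ (-(1/2) - H/2)) := by
          rw [← rpow_add hu0]; ring_nf
      _ ≤ (u - s) ^ (H - 1/2) * (s ^ (3/2 * H - 1) * (u - s) ^ (-(1/2) - H/2)) := by
          gcongr ?_ * (?_ * ?_)
          · exact rpow_le_rpow_of_nonpos hs hu.le (by linarith)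
          · exact rpow_le_rpow_of_nonpos hus (by linarith) (by linarith)
      _ = s ^ (3/2 * H - 1) * ((u - s) ^ (H - 1/2) * (u - s) ^ (-(1/2) - H/2)) := by ring
      _ = s ^ (3/2 * H - 1) * (u - s) ^ (H/2 - 1) := by
          rw [← rpow_add hus]; ring_nf
  have ht0 : 0 < t := hs.trans hst
  have hts : 0 < t - s := by linarith
  have hs0 : 0 ≤ s ^ ((1:ℝ)/2 - H) := rpow_nonneg hs.le _
  have hboundary : s ^ ((1:ℝ)/2 - H) * (t * (t - s)) ^ (H - 1/2) ≤ (t - s) ^ (H - 1/2) := by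
    rw [mul_rpow ht0.le hts.le, ← mul_assoc]
    refine mul_le_of_le_one_left (by positivity) ?_
    calc s ^ ((1:ℝ)/2 - H) * t ^ (H - 1/2) ≤ s ^ ((1:ℝ)/2 - H) * s ^ (H - 1/2) := by
          gcongr ?_ * ?_
          exact rpow_le_rpow_of_nonpos hs hst.le (by linarith)
      _ = 1 := by rw [← rpow_add hs]; simp
  rw [KH, if_pos hH, abs_mul, abs_of_nonneg (mul_nonneg hk hs0), mul_assoc]
  gcongr
  set I := ∫ u in Set.Ioo s t, (u - s) ^ (H - 1/2) * u ^ (H - 3/2)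
  have hH2 : 0 < 1/2 - H := by linarith
  calc s ^ ((1:ℝ)/2 - H) * |(t * (t - s)) ^ (H - 1/2) - (H - 1/2) * I|
      ≤ s ^ ((1:ℝ)/2 - H) *
          ((t * (t - s)) ^ (H - 1/2) + (1/2 - H) * (s ^ (3/2 * H - 1) / (H/2 - 1 + 1))) := by
        gcongr
        refine (abs_sub _ _).trans ?_
        rw [abs_mul, abs_of_neg (show H - 1/2 < 0 by linarith), neg_sub,
          abs_of_nonneg (show 0 ≤ (t * (t - s)) ^ (H - 1/2) by positivity)]
        gcongr
    _ = s ^ ((1:ℝ)/2 - H) * (t * (t - s)) ^ (H - 1/2) +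
          (1/2 - H) * (2 / H) * (s ^ ((1:ℝ)/2 - H) * s ^ (3/2 * H - 1)) := by
        rw [sub_add_cancel]; field_simp
    _ = s ^ ((1:ℝ)/2 - H) * (t * (t - s)) ^ (H - 1/2) +
          (1/2 - H) * (2 / H) * s ^ (H/2 - 1/2) := by
        rw [← rpow_add hs]; ring_nf
    _ ≤ _ := by gcongr

theorem stmt18 (H t : ℝ) (hH : H ∈ Set.Ioo (0:ℝ) 1) (hH' : H ≠ 1/2)
    (ht : t ∈ Set.Ioc (0:ℝ) 1) :
    MeasureTheory.IntegrableOn (fun s => (KH H t s) ^ 2) (Set.Ioo 0 t) := by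
  obtain ⟨hH0, hH1⟩ := hH
  obtain ⟨ht0, ht1⟩ := ht
  have hmeas := ((measurable_KH H t).pow_const 2).aestronglyMeasurable
    (μ := volume.restrict (Set.Ioo 0 t))
  have hpow {a : ℝ} (ha : -1 < a) : IntegrableOn (fun s => s ^ a) (Set.Ioo 0 t) := by
    simpa using integrableOn_Ioo_sub_left_rpow ht0.le ha
  have hsq {x : ℝ} (hx : 0 ≤ x) (a : ℝ) : (x ^ a) ^ 2 = x ^ (2 * a) := by
    rw [← rpow_natCast, ← rpow_mul hx, mul_comm]; norm_num
  rcases lt_or_gt_of_ne hH' with h | h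
  · set c := (1/2 - H) * (2 / H)
    refine Integrable.mono'
      (((integrableOn_Ioo_sub_right_rpow (a := 2 * (H - 1/2)) ht0.le (by linarith)).add
        ((hpow (a := 2 * (H/2 - 1/2)) (by linarith)).const_mul (c ^ 2))).const_mul
          (2 * kappaH H ^ 2)) hmeas
      ((ae_restrict_iff' measurableSet_Ioo).2 (Filter.Eventually.of_forall ?_))
    rintro s ⟨hs, hst⟩
    have hb := abs_KH_le_of_lt_half hH0 h hs hst ht1
    simp only [norm_pow, norm_eq_abs, Pi.add_apply]
    rw [← hsq (sub_nonneg.2 hst.le), ← hsq hs.le]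
    calc |KH H t s| ^ 2
        ≤ (kappaH H * ((t - s) ^ (H - 1/2) + c * s ^ (H/2 - 1/2))) ^ 2 := by gcongr
      _ = kappaH H ^ 2 * ((t - s) ^ (H - 1/2) + c * s ^ (H/2 - 1/2)) ^ 2 := mul_pow _ _ _
      _ ≤ kappaH H ^ 2 * (2 * (((t - s) ^ (H - 1/2)) ^ 2 + (c * s ^ (H/2 - 1/2)) ^ 2)) := by
          gcongr
          exact add_sq_le
      _ = _ := by ring
  · refine Integrable.mono'
      ((hpow (a := 2 * (1/2 - H)) (by linarith)).const_mul (kappaH H ^ 2)) hmeas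
      ((ae_restrict_iff' measurableSet_Ioo).2 (Filter.Eventually.of_forall ?_))
    rintro s ⟨hs, hst⟩
    have hb := abs_KH_le_of_half_lt h hs hst ht1
    simp only [norm_pow, norm_eq_abs]
    rw [← hsq hs.le, ← mul_pow]
    gcongr
end
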